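/- On the hexagonal lattice: suppose e^{β_L} ≪ L^{2/3}, fix a constant α ∈ (0,1), and suppose in addition that L^{(2/3)(1−α)} ≪ e^{β_L}. Then for every constant c > 0, μ_{β_L}(X_{[0, cL^{2α}]}) = 1 − o_L(1) as L → ∞. -/

import Mathlib

open scoped Classical BigOperators

namespace IsingHex

/-- Sites of the hexagonal lattice of side length `L` with periodic boundary conditions,
identified with the `2L²` triangular faces of the dual triangular lattice `Λ*`:
`(p, false)` is the up-triangle and `(p, true)` the down-triangle in the rhombic cell `p`. -/
abbrev Site (L : ℕ) : Type := (ZMod L × ZMod L) × Bool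

/-- Spin configurations `X = Ω^Λ` with spin set `Ω = Fin q`. -/
abbrev Conf (L q : ℕ) : Type := Site L → Fin q

/-- Adjacency of the hexagonal lattice: the up-triangle `(p, false)` is adjacent to the
down-triangles `(p, true)`, `(p - (1,0), true)` and `(p - (0,1), true)`. -/
def hexAdj {L : ℕ} (v w : Site L) : Prop :=
  (v.2 = false ∧ w.2 = true ∧
     (w.1 = v.1 ∨ w.1 = (v.1.1 - 1, v.1.2) ∨ w.1 = (v.1.1, v.1.2 - 1))) ∨
  (v.2 = true ∧ w.2 = false ∧
     (v.1 = w.1 ∨ v.1 = (w.1.1 - 1, w.1.2) ∨ v.1 = (w.1.1, w.1.2 - 1)))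

/-- The Hamiltonian `H(σ)`: the number of edges of `Λ` whose endpoints carry different
spins; each edge is counted exactly once through its unique up-triangle endpoint. -/
noncomputable def Ham (L q : ℕ) (σ : Conf L q) : ℕ :=
  Nat.card {e : Site L × Site L // e.1.2 = false ∧ hexAdj e.1 e.2 ∧ σ e.1 ≠ σ e.2}

/-- The monochromatic ground state `𝐚`. -/
def groundConf (L q : ℕ) (a : Fin q) : Conf L q := fun _ => a

/-- The set `S = {𝟏, …, 𝐪}` of ground states. -/
def groundSet (L q : ℕ) : Set (Conf L q) := {σ | ∃ a : Fin q, σ = groundConf L q a}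

/-- Partition function `Z_β`. -/
noncomputable def Zfun (L q : ℕ) (β : ℝ) : ℝ :=
  ∑' σ : Conf L q, Real.exp (-β * (Ham L q σ : ℝ))

/-- Gibbs measure of a set of configurations. -/
noncomputable def gibbsP (L q : ℕ) (β : ℝ) (A : Set (Conf L q)) : ℝ :=
  (∑' σ : Conf L q, A.indicator (fun ζ => Real.exp (-β * (Ham L q ζ : ℝ))) σ) / Zfun L q β

/-- `σ ∼ ζ`: the two configurations differ at exactly one site. -/
def oneFlip {L q : ℕ} (σ ζ : Conf L q) : Prop :=
  ∃ x : Site L, σ x ≠ ζ x ∧ ∀ y : Site L, y ≠ x → σ y = ζ y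

/-- Metropolis jump rates `c_β(σ, ζ)`. -/
noncomputable def rate (L q : ℕ) (β : ℝ) (σ ζ : Conf L q) : ℝ :=
  if oneFlip σ ζ then Real.exp (-β * max ((Ham L q ζ : ℝ) - (Ham L q σ : ℝ)) 0) else 0

/-- There is a `t`-path of single spin flips connecting `σ` and `ζ`. -/
def ConnBelow (L q : ℕ) (t : ℕ) (σ ζ : Conf L q) : Prop :=
  ∃ (N : ℕ) (ω : ℕ → Conf L q), ω 0 = σ ∧ ω N = ζ ∧
    (∀ n < N, oneFlip (ω n) (ω (n + 1))) ∧ ∀ n ≤ N, Ham L q (ω n) ≤ t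

/-- Communication height `Φ(σ, ζ)`. -/
noncomputable def commHeight (L q : ℕ) (σ ζ : Conf L q) : ℕ :=
  sInf {t : ℕ | ConnBelow L q t σ ζ}

/-- The strip of index `ℓ` in direction `d` (`0` = horizontal, `1` = vertical,
`2` = diagonal): `2L` consecutive triangles winding around the torus. -/
def stripSet (L : ℕ) (d : Fin 3) (ℓ : ZMod L) : Set (Site L) :=
  if d = 0 then {v | v.1.2 = ℓ}
  else if d = 1 then {v | v.1.1 = ℓ}
  else {v | (v.2 = false ∧ v.1.1 + v.1.2 = ℓ) ∨ (v.2 = true ∧ v.1.1 + v.1.2 = ℓ - 1)}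

/-- Strip energy `ΔH_s(σ)`: number of adjacent pairs inside the strip with different spins. -/
noncomputable def stripEnergy (L q : ℕ) (σ : Conf L q) (d : Fin 3) (ℓ : ZMod L) : ℕ :=
  Nat.card {e : Site L × Site L //
    e.1.2 = false ∧ e.1 ∈ stripSet L d ℓ ∧ e.2 ∈ stripSet L d ℓ ∧
      hexAdj e.1 e.2 ∧ σ e.1 ≠ σ e.2}

/-- The strip `(d, ℓ)` is an `a`-bridge of `σ`. -/
def IsBridgeWith (L q : ℕ) (σ : Conf L q) (d : Fin 3) (ℓ : ZMod L) (a : Fin q) : Prop :=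
  ∀ v ∈ stripSet L d ℓ, σ v = a

/-- The strip `(d, ℓ)` is a bridge of `σ`. -/
def IsBridge (L q : ℕ) (σ : Conf L q) (d : Fin 3) (ℓ : ZMod L) : Prop :=
  ∃ a : Fin q, IsBridgeWith L q σ d ℓ a

/-- Cyclic enumeration of the strip `(d, ℓ)` by `ZMod (2L)`, consecutive triangles
being adjacent. -/
def stripCycle (L : ℕ) (d : Fin 3) (ℓ : ZMod L) (k : ZMod (2 * L)) : Site L :=
  let t : ZMod L := ((k.val / 2 : ℕ) : ZMod L)
  if d = 0 then ((t, ℓ), decide (k.val % 2 = 1))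
  else if d = 1 then ((ℓ, t), decide (k.val % 2 = 1))
  else if k.val % 2 = 1 then ((t, ℓ - 1 - t), true) else ((t, ℓ - t), false)

/-- A set of triangles is an arc (a set of consecutive triangles) of the strip `(d, ℓ)`. -/
def IsArc (L : ℕ) (d : Fin 3) (ℓ : ZMod L) (S : Set (Site L)) : Prop :=
  ∃ (s : ZMod (2 * L)) (m : ℕ),
    S = (fun k : ℕ => stripCycle L d ℓ (s + (k : ZMod (2 * L)))) '' Set.Iio m

/-- The strip `(d, ℓ)` is an `{a,b}`-semibridge of `σ`: it carries exactly the two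
spins `a ≠ b`, and the sites carrying each spin are consecutive in the strip. -/
def IsSemibridgePair (L q : ℕ) (σ : Conf L q) (d : Fin 3) (ℓ : ZMod L) (a b : Fin q) : Prop :=
  a ≠ b ∧ (∀ v ∈ stripSet L d ℓ, σ v = a ∨ σ v = b) ∧
    (∃ v ∈ stripSet L d ℓ, σ v = a) ∧ (∃ v ∈ stripSet L d ℓ, σ v = b) ∧
    IsArc L d ℓ {v ∈ stripSet L d ℓ | σ v = a} ∧ IsArc L d ℓ {v ∈ stripSet L d ℓ | σ v = b}

/-- The strip `(d, ℓ)` is a semibridge of `σ`. -/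
def IsSemibridge (L q : ℕ) (σ : Conf L q) (d : Fin 3) (ℓ : ZMod L) : Prop :=
  ∃ a b : Fin q, IsSemibridgePair L q σ d ℓ a b

/-- `σ` has an `a`-cross: two `a`-bridges in different directions. -/
def HasCross (L q : ℕ) (σ : Conf L q) (a : Fin q) : Prop :=
  ∃ (d d' : Fin 3) (ℓ ℓ' : ZMod L),
    d ≠ d' ∧ IsBridgeWith L q σ d ℓ a ∧ IsBridgeWith L q σ d' ℓ' a

/-- `σ` is cross-free. -/
def CrossFree (L q : ℕ) (σ : Conf L q) : Prop := ∀ a : Fin q, ¬ HasCross L q σ a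

/-- Connected subsets of the torus `𝕋_L` of strip indices (the collection `𝔖_L`). -/
def CircConn (L : ℕ) (P : Set (ZMod L)) : Prop :=
  ∀ x ∈ P, ∀ y ∈ P, ∃ (N : ℕ) (γ : ℕ → ZMod L), γ 0 = x ∧ γ N = y ∧
    (∀ n ≤ N, γ n ∈ P) ∧ ∀ n < N, γ (n + 1) = γ n + 1 ∨ γ (n + 1) = γ n - 1

/-- Union of the strips with indices in `P`, in direction `d`. -/
def stripUnion (L : ℕ) (d : Fin 3) (P : Set (ZMod L)) : Set (Site L) :=
  ⋃ ℓ ∈ P, stripSet L d ℓ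

/-- The configuration `ξ^{a,b}_U`: spin `b` on `U` and spin `a` elsewhere. -/
noncomputable def xiConf (L q : ℕ) (a b : Fin q) (U : Set (Site L)) : Conf L q :=
  fun v => if v ∈ U then b else a

/-- `σ ∈ R_n^{a,b}`: a regular configuration between `𝐚` and `𝐛` built from `n` strips. -/
def IsRegular (L q : ℕ) (σ : Conf L q) (a b : Fin q) (n : ℕ) : Prop :=
  ∃ (d : Fin 3) (P : Set (ZMod L)), CircConn L P ∧ P.ncard = n ∧
    σ = xiConf L q a b (stripUnion L d P)

/-- The vertices (in the triangular lattice) of the triangle `v`. -/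
def triVerts (L : ℕ) (v : Site L) : Set (ZMod L × ZMod L) :=
  if v.2 = false then {v.1, (v.1.1 + 1, v.1.2), (v.1.1, v.1.2 + 1)}
  else {(v.1.1 + 1, v.1.2), (v.1.1, v.1.2 + 1), (v.1.1 + 1, v.1.2 + 1)}

/-- A connected set of triangles (connected through shared sides). -/
def ConnSet (L : ℕ) (U : Set (Site L)) : Prop :=
  ∀ x ∈ U, ∀ y ∈ U, ∃ (N : ℕ) (γ : ℕ → Site L), γ 0 = x ∧ γ N = y ∧
    (∀ n ≤ N, γ n ∈ U) ∧ ∀ n < N, hexAdj (γ n) (γ (n + 1))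

/-- A one-dimensional canonical set inside the strip `(d, ℓ)`. -/
def OneDimCanonical (L : ℕ) (d : Fin 3) (ℓ : ZMod L) (U : Set (Site L)) : Prop :=
  U ⊆ stripSet L d ℓ ∧ U.Nonempty ∧ U ≠ stripSet L d ℓ ∧
  (ConnSet L U ∨
    (Even U.ncard ∧ ∃ (U₁ : Set (Site L)) (y : Site L),
      U = U₁ ∪ {y} ∧ y ∉ U₁ ∧ U₁.Nonempty ∧ ConnSet L U₁ ∧
      (∀ x ∈ U₁, ¬ hexAdj x y) ∧ ∃ x ∈ U₁, (triVerts L x ∩ triVerts L y).Nonempty))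

/-- `P ≺ P'`: connected index sets with `P ⊆ P'` and `|P'| = |P| + 1`. -/
def StepPair (L : ℕ) (P P' : Set (ZMod L)) : Prop :=
  CircConn L P ∧ CircConn L P' ∧ P ⊆ P' ∧ P'.ncard = P.ncard + 1

/-- A protuberance attached to `s(P)` inside the strip `(d, ℓ)`: a one-dimensional
canonical set such that, when `1 ≤ |P| ≤ L-2`, at least half of its triangles share a
side with `s(P)`. -/
def IsProtuberance (L : ℕ) (d : Fin 3) (P : Set (ZMod L)) (ℓ : ZMod L)
    (U : Set (Site L)) : Prop :=
  OneDimCanonical L d ℓ U ∧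
    (1 ≤ P.ncard → P.ncard ≤ L - 2 →
      U.ncard ≤ 2 * {x ∈ U | ∃ y ∈ stripUnion L d P, hexAdj x y}.ncard)

/-- `‖σ‖_a`: the number of sites with spin `a`. -/
noncomputable def spinCount (L q : ℕ) (σ : Conf L q) (a : Fin q) : ℕ :=
  Nat.card {x : Site L // σ x = a}

/-- `N̂(S)`: configurations connected to a ground state by a `(2L+2)`-path. -/
def NHatGround (L q : ℕ) : Set (Conf L q) :=
  {ζ | ∃ a : Fin q, ConnBelow L q (2 * L + 2) (groundConf L q a) ζ}

/-- A nice pair of configurations (relative to the partition class `A`). -/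
def NicePair (L q : ℕ) (A : Finset (Fin q)) (σ ζ : Conf L q) : Prop :=
  σ ∉ NHatGround L q ∧ ζ ∉ NHatGround L q ∧ oneFlip σ ζ ∧
    (∑ a ∈ A, spinCount L q σ a) = L ^ 2 ∧ (∑ a ∈ A, spinCount L q ζ a) = L ^ 2 - 1

/-- `u` is the vector of mean hitting times `σ ↦ E_σ[τ_A]` of the Metropolis dynamics:
it vanishes on `A` and satisfies the first-step (harmonicity) equations off `A`. -/
def IsMeanHittingTime (L q : ℕ) (β : ℝ) (A : Set (Conf L q)) (u : Conf L q → ℝ) : Prop :=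
  (∀ σ ∈ A, u σ = 0) ∧
    ∀ σ ∉ A, (∑' ζ : Conf L q, rate L q β σ ζ) * u σ =
      1 + ∑' ζ : Conf L q, rate L q β σ ζ * u ζ

/-- Gibbs weight `μ_β(σ)`. -/
noncomputable def gibbsWeight (L q : ℕ) (β : ℝ) (σ : Conf L q) : ℝ :=
  Real.exp (-β * (Ham L q σ : ℝ)) / Zfun L q β

/-- The Dirichlet form `D_β(f)`. -/
noncomputable def dirichletForm (L q : ℕ) (β : ℝ) (f : Conf L q → ℝ) : ℝ :=
  (1 / 2) * ∑' p : Conf L q × Conf L q,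
    gibbsWeight L q β p.1 * rate L q β p.1 p.2 * (f p.2 - f p.1) ^ 2

/-- `h` is the equilibrium potential `h^β_{A,B}(σ) = P_σ[τ_A < τ_B]`: it equals `1` on
`A`, `0` on `B`, and is harmonic for the Metropolis dynamics off `A ∪ B`. -/
def IsEqPotential (L q : ℕ) (β : ℝ) (A B : Set (Conf L q)) (h : Conf L q → ℝ) : Prop :=
  (∀ σ ∈ A, h σ = 1) ∧ (∀ σ ∈ B, h σ = 0) ∧
    ∀ σ, σ ∉ A → σ ∉ B → (∑' ζ : Conf L q, rate L q β σ ζ * (h σ - h ζ)) = 0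



/-! ### Local geometry: a disagreement edge forces three disagreement edges nearby -/

def dx (j : Fin 3) : ℤ := if j = 1 then 1 else 0
def dy (j : Fin 3) : ℤ := if j = 2 then 1 else 0

lemma three_le_card {τ : Type*} [DecidableEq τ] (B A1 A2 : Finset τ) (t0 : τ) (E : τ → Prop)
    [DecidablePred E]
    (h0B : t0 ∈ B) (h1B : A1 ⊆ B) (h2B : A2 ⊆ B) (h01 : t0 ∉ A1) (h02 : t0 ∉ A2)
    (h12 : Disjoint A1 A2) (h0 : E t0) (h1 : ∃ t ∈ A1, E t) (h2 : ∃ t ∈ A2, E t) :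
    3 ≤ (B.filter E).card := by
  obtain ⟨t1, ht1, hE1⟩ := h1
  obtain ⟨t2, ht2, hE2⟩ := h2
  have hne : t1 ≠ t2 := fun h => Finset.disjoint_left.mp h12 ht1 (h ▸ ht2)
  have hne1 : t0 ≠ t1 := fun h => h01 (h ▸ ht1)
  have hne2 : t0 ≠ t2 := fun h => h02 (h ▸ ht2)
  have : ({t0, t1, t2} : Finset τ).card = 3 := by
    rw [Finset.card_eq_three]; exact ⟨t0, t1, t2, hne1, hne2, hne, rfl⟩
  rw [← this]
  apply Finset.card_le_card
  intro t ht
  simp only [Finset.mem_insert, Finset.mem_singleton] at ht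
  rw [Finset.mem_filter]
  rcases ht with rfl | rfl | rfl
  · exact ⟨h0B, h0⟩
  · exact ⟨h1B ht1, hE1⟩
  · exact ⟨h2B ht2, hE2⟩

noncomputable def lbox : Finset (ℤ × ℤ × Fin 3) :=
  Finset.Icc (-1) 1 ×ˢ Finset.Icc (-1) 1 ×ˢ Finset.univ

lemma local3 {α : Type*} (u w : ℤ → ℤ → α) (j : Fin 3)
    (h : u 0 0 ≠ w (0 - dx j) (0 - dy j)) :
    3 ≤ (lbox.filter
      (fun t => u t.1 t.2.1 ≠ w (t.1 - dx t.2.2) (t.2.1 - dy t.2.2))).card := by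
  fin_cases j
  · refine three_le_card lbox {(1,0,1),(0,0,2),(1,-1,1),(1,-1,0),(1,0,2)}
      {(0,1,1),(-1,1,0),(-1,1,2),(0,0,1),(0,1,2)} (0,0,0) _ (by decide) (by decide) (by decide)
      (by decide) (by decide) (by decide) h ?_ ?_ <;>
    · by_contra hc
      push Not at hc
      simp [dx, dy] at hc h
      grind
  · refine three_le_card lbox {(-1,0,0),(-1,0,2),(0,-1,1),(0,-1,0),(0,0,2)}
      {(0,1,1),(-1,1,0),(-1,1,2),(0,0,0),(0,1,2)} (0,0,1) _ (by decide) (by decide) (by decide)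
      (by decide) (by decide) (by decide) h ?_ ?_ <;>
    · by_contra hc
      push Not at hc
      simp [dx, dy] at hc h
      grind
  · refine three_le_card lbox {(0,0,1),(-1,0,0),(-1,0,2),(0,-1,1),(0,-1,0)}
      {(1,0,1),(0,0,0),(1,-1,1),(1,-1,0),(1,0,2)} (0,0,2) _ (by decide) (by decide) (by decide)
      (by decide) (by decide) (by decide) h ?_ ?_ <;>
    · by_contra hc
      push Not at hc
      simp [dx, dy] at hc h
      grind

/-! ### Torus -/

/-- Translate of the cell `p`. -/
def tr {L : ℕ} (p : ZMod L × ZMod L) (a b : ℤ) : ZMod L × ZMod L := (p.1 + a, p.2 + b)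

/-- Disagreement of the edge of type `j` at the up-triangle of the cell `p`. -/
def Dis {L q : ℕ} (σ : Conf L q) (p : ZMod L × ZMod L) (j : Fin 3) : Prop :=
  σ (p, false) ≠ σ (tr p (- dx j) (- dy j), true)

lemma tr_tr {L : ℕ} (p : ZMod L × ZMod L) (a b c d : ℤ) :
    tr (tr p a b) c d = tr p (a + c) (b + d) := by
  simp [tr, add_assoc]

lemma tr_zero {L : ℕ} (p : ZMod L × ZMod L) : tr p 0 0 = p := by simp [tr]

lemma small_int {L : ℕ} (hL : 8 ≤ L) {a b : ℤ} (ha : a ∈ Finset.Icc (-1 : ℤ) 1)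
    (hb : b ∈ Finset.Icc (-1 : ℤ) 1) (h : (a : ZMod L) = b) : a = b := by
  rw [ZMod.intCast_eq_intCast_iff_dvd_sub] at h
  rw [Finset.mem_Icc] at ha hb
  obtain ⟨k, hk⟩ := h
  have hL' : (8 : ℤ) ≤ L := by exact_mod_cast hL
  have : k = 0 := by
    by_contra hk0
    rcases lt_or_gt_of_ne hk0 with h1 | h1 <;> nlinarith
  subst this
  linarith

lemma tr_inj {L : ℕ} (hL : 8 ≤ L) (p : ZMod L × ZMod L) {a b c d : ℤ}
    (ha : a ∈ Finset.Icc (-1 : ℤ) 1) (hb : b ∈ Finset.Icc (-1 : ℤ) 1)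
    (hc : c ∈ Finset.Icc (-1 : ℤ) 1) (hd : d ∈ Finset.Icc (-1 : ℤ) 1)
    (h : tr p a b = tr p c d) : a = c ∧ b = d := by
  simp only [tr, Prod.mk.injEq, add_right_inj] at h
  exact ⟨small_int hL ha hc h.1, small_int hL hb hd h.2⟩

lemma dx_mem (j : Fin 3) : - dx j ∈ Finset.Icc (-1 : ℤ) 1 := by revert j; decide
lemma dy_mem (j : Fin 3) : - dy j ∈ Finset.Icc (-1 : ℤ) 1 := by revert j; decide
lemma d_inj (i j : Fin 3) : dx i = dx j → dy i = dy j → i = j := by revert i j; decide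

lemma card_dis_le_Ham {L q : ℕ} [NeZero L] (hL : 8 ≤ L) (σ : Conf L q) :
    (Finset.univ.filter (fun x : (ZMod L × ZMod L) × Fin 3 => Dis σ x.1 x.2)).card
      ≤ Ham L q σ := by
  rw [Ham, Nat.card_eq_fintype_card, Fintype.card_subtype]
  refine Finset.card_le_card_of_injOn
    (fun x => ((x.1, false), (tr x.1 (- dx x.2) (- dy x.2), true))) ?_ ?_
  · rintro ⟨p, j⟩ h
    simp only [Finset.coe_filter, Finset.mem_univ, true_and, Set.mem_ofPred_eq] at h ⊢
    refine ⟨Or.inl ⟨rfl, rfl, ?_⟩, h⟩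
    fin_cases j
    · left; simp [tr, dx, dy]
    · right; left; simp [tr, dx, dy, sub_eq_add_neg]
    · right; right; simp [tr, dx, dy, sub_eq_add_neg]
  · rintro ⟨p, i⟩ _ ⟨p', j⟩ _ h
    simp only [Prod.mk.injEq, and_true] at h
    obtain ⟨rfl, h⟩ := h
    have := tr_inj hL p (dx_mem i) (dy_mem i) (dx_mem j) (dy_mem j) h
    have := d_inj i j (by linarith [this.1]) (by linarith [this.2])
    rw [this]

/-- Box of radius one. -/
noncomputable def box {L : ℕ} (p : ZMod L × ZMod L) : Finset (ZMod L × ZMod L) :=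
  (Finset.Icc (-1 : ℤ) 1 ×ˢ Finset.Icc (-1 : ℤ) 1).image (fun t => tr p t.1 t.2)

lemma local_torus {L q : ℕ} [NeZero L] (hL : 8 ≤ L) (σ : Conf L q) (p : ZMod L × ZMod L)
    (h : ∃ j, Dis σ p j) :
    3 ≤ (Finset.univ.filter
      (fun x : (ZMod L × ZMod L) × Fin 3 => x.1 ∈ box p ∧ Dis σ x.1 x.2)).card := by
  obtain ⟨j, hj⟩ := h
  have h3 := local3 (fun a b => σ (tr p a b, false)) (fun a b => σ (tr p a b, true)) j (by
    simpa [Dis, tr_zero] using hj)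
  refine h3.trans (Finset.card_le_card_of_injOn (fun t => (tr p t.1 t.2.1, t.2.2)) ?_ ?_)
  · rintro ⟨a, b, k⟩ ht
    simp only [Finset.coe_filter, Set.mem_ofPred_eq, lbox, Finset.mem_product] at ht
    simp only [Finset.coe_filter, Finset.mem_univ, true_and, Set.mem_ofPred_eq]
    refine ⟨Finset.mem_image.mpr ⟨(a, b), Finset.mem_product.mpr ⟨ht.1.1, ht.1.2.1⟩, rfl⟩, ?_⟩
    simpa [Dis, tr_tr, sub_eq_add_neg] using ht.2
  · rintro ⟨a, b, k⟩ ht ⟨a', b', k'⟩ ht' h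
    simp only [Finset.coe_filter, Set.mem_ofPred_eq, lbox, Finset.mem_product] at ht ht'
    simp only [Prod.mk.injEq] at h
    obtain ⟨rfl, rfl⟩ := tr_inj hL p ht.1.1 ht.1.2.1 ht'.1.1 ht'.1.2.1 h.1
    rw [h.2]

lemma exists_packing {τ κ : Type*} [DecidableEq τ] [DecidableEq κ] (bx : τ → Finset κ)
    (hne : ∀ p, (bx p).Nonempty) (A : Finset τ) :
    ∃ R ⊆ A, (∀ r ∈ R, ∀ s ∈ R, r ≠ s → Disjoint (bx r) (bx s)) ∧
      ∀ p ∈ A, ∃ r ∈ R, ¬ Disjoint (bx p) (bx r) := by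
  induction A using Finset.induction_on with
  | empty => exact ⟨∅, by simp⟩
  | insert a A ha ih =>
    obtain ⟨R, hRA, hsep, hmax⟩ := ih
    by_cases hh : ∃ r ∈ R, ¬ Disjoint (bx a) (bx r)
    · refine ⟨R, hRA.trans (Finset.subset_insert _ _), hsep, ?_⟩
      intro p hp
      rcases Finset.mem_insert.mp hp with rfl | hp
      · exact hh
      · exact hmax p hp
    · push Not at hh
      refine ⟨insert a R, Finset.insert_subset_insert _ hRA, ?_, ?_⟩
      · intro r hr s hs hrs
        rcases Finset.mem_insert.mp hr with hra | hr1 <;>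
          rcases Finset.mem_insert.mp hs with hsa | hs1
        · exact absurd (hra.trans hsa.symm) hrs
        · exact hra ▸ hh s hs1
        · exact hsa ▸ (hh r hr1).symm
        · exact hsep r hr1 s hs1 hrs
      · intro p hp
        rcases Finset.mem_insert.mp hp with rfl | hp
        · refine ⟨p, Finset.mem_insert_self _ _, ?_⟩
          rw [disjoint_self]
          exact (hne p).ne_empty
        · obtain ⟨r, hr, h⟩ := hmax p hp
          exact ⟨r, Finset.mem_insert_of_mem hr, h⟩

lemma exists_root {L q : ℕ} [NeZero L] (hL : 8 ≤ L) (σ : Conf L q) :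
    ∃ R : Finset (ZMod L × ZMod L), 3 * R.card ≤ Ham L q σ ∧
      ∀ p j, Dis σ p j → ∃ r ∈ R, ∃ a ∈ Finset.Icc (-2 : ℤ) 2, ∃ b ∈ Finset.Icc (-2 : ℤ) 2,
        p = tr r a b := by
  obtain ⟨R, hRA, hsep, hmax⟩ := exists_packing (fun p : ZMod L × ZMod L => box p)
    (fun p => ⟨tr p 0 0, Finset.mem_image.mpr ⟨(0, 0), by decide, rfl⟩⟩)
    (Finset.univ.filter (fun p => ∃ j, Dis σ p j))
  refine ⟨R, ?_, ?_⟩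
  · refine le_trans ?_ (card_dis_le_Ham hL σ)
    let S : ZMod L × ZMod L → Finset ((ZMod L × ZMod L) × Fin 3) := fun p => Finset.univ.filter
      (fun x : (ZMod L × ZMod L) × Fin 3 => x.1 ∈ box p ∧ Dis σ x.1 x.2)
    have h1 : (R.biUnion S).card = ∑ r ∈ R, (S r).card := by
      apply Finset.card_biUnion
      intro r hr s hs hrs
      refine Finset.disjoint_left.mpr ?_
      intro x hx hx'
      exact Finset.disjoint_left.mp (hsep r hr s hs hrs)
        (Finset.mem_filter.mp hx).2.1 (Finset.mem_filter.mp hx').2.1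
    have h2 : 3 * R.card ≤ ∑ r ∈ R, (S r).card := by
      rw [mul_comm, ← smul_eq_mul]
      apply Finset.card_nsmul_le_sum
      intro r hr
      exact local_torus hL σ r (Finset.mem_filter.mp (hRA hr)).2
    rw [← h1] at h2
    refine h2.trans (Finset.card_le_card ?_)
    intro x hx
    obtain ⟨r, _, hx⟩ := Finset.mem_biUnion.mp hx
    exact Finset.mem_filter.mpr ⟨Finset.mem_univ _, (Finset.mem_filter.mp hx).2.2⟩
  · intro p j hj
    obtain ⟨r, hr, hd⟩ := hmax p (Finset.mem_filter.mpr ⟨Finset.mem_univ _, j, hj⟩)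
    refine ⟨r, hr, ?_⟩
    rw [Finset.not_disjoint_iff] at hd
    obtain ⟨z, hz1, hz2⟩ := hd
    obtain ⟨⟨a, b⟩, hab, rfl⟩ := Finset.mem_image.mp hz1
    obtain ⟨⟨c, d⟩, hcd, h⟩ := Finset.mem_image.mp hz2
    simp only [Finset.mem_product, Finset.mem_Icc] at hab hcd
    refine ⟨c - a, Finset.mem_Icc.mpr (by omega), d - b, Finset.mem_Icc.mpr (by omega), ?_⟩
    have h' := congrArg (fun z => tr z (-a) (-b)) h
    simp only [tr_tr] at h'
    simpa [tr_zero, sub_eq_add_neg] using h'.symm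

/-- Sites close to the root set `R`. -/
noncomputable def nearSites {L : ℕ} (R : Finset (ZMod L × ZMod L)) : Finset (Site L) :=
  (R ×ˢ (Finset.Icc (-3 : ℤ) 3 ×ˢ Finset.Icc (-3 : ℤ) 3) ×ˢ (Finset.univ : Finset Bool)).image
    (fun t => (tr t.1 t.2.1.1 t.2.1.2, t.2.2))

lemma card_nearSites {L : ℕ} (R : Finset (ZMod L × ZMod L)) :
    (nearSites R).card ≤ 98 * R.card := by
  refine Finset.card_image_le.trans ?_
  simp only [Finset.card_product, Int.card_Icc, Finset.card_univ, Fintype.card_bool]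
  have h7 : ((3 : ℤ) + 1 - -3).toNat = 7 := rfl
  rw [h7]
  omega

/-- The property of root sets. -/
def IsRoot {L q : ℕ} (σ : Conf L q) (R : Finset (ZMod L × ZMod L)) : Prop :=
  ∀ p j, Dis σ p j → ∃ r ∈ R, ∃ a ∈ Finset.Icc (-2 : ℤ) 2, ∃ b ∈ Finset.Icc (-2 : ℤ) 2,
        p = tr r a b

lemma dis_mem {L q : ℕ} {σ : Conf L q} {R : Finset (ZMod L × ZMod L)} (h : IsRoot σ R)
    {p : ZMod L × ZMod L} {j : Fin 3} (hd : Dis σ p j) :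
    ((p, false) : Site L) ∈ nearSites R ∧
      ((tr p (- dx j) (- dy j), true) : Site L) ∈ nearSites R := by
  obtain ⟨r, hr, a, ha, b, hb, rfl⟩ := h p j hd
  have hx := dx_mem j
  have hy := dy_mem j
  rw [Finset.mem_Icc] at *
  constructor
  · refine Finset.mem_image.mpr ⟨(r, (a, b), false), ?_, rfl⟩
    simp only [Finset.mem_product, Finset.mem_Icc, Finset.mem_univ, and_true]
    exact ⟨hr, by omega, by omega⟩
  · refine Finset.mem_image.mpr ⟨(r, (a + - dx j, b + - dy j), true), ?_, by rw [tr_tr]⟩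
    simp only [Finset.mem_product, Finset.mem_Icc, Finset.mem_univ, and_true]
    exact ⟨hr, by omega, by omega⟩

lemma agree_all {L q : ℕ} [NeZero L] {σ τ : Conf L q} {R : Finset (ZMod L × ZMod L)}
    (hσ : IsRoot σ R) (hτ : IsRoot τ R) (hR : ∀ x ∈ nearSites R, σ x = τ x)
    (h0 : σ ((0, 0), false) = τ ((0, 0), false)) : σ = τ := by
  have step : ∀ p j, σ (p, false) = τ (p, false) ↔
      σ (tr p (- dx j) (- dy j), true) = τ (tr p (- dx j) (- dy j), true) := by
    intro p j
    by_cases h1 : Dis σ p j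
    · have := dis_mem hσ h1
      simp [hR _ this.1, hR _ this.2]
    · by_cases h2 : Dis τ p j
      · have := dis_mem hτ h2
        simp [hR _ this.1, hR _ this.2]
      · unfold Dis at h1 h2
        push Not at h1 h2
        rw [h1, h2]
  have s0 : ∀ p, σ (p, false) = τ (p, false) ↔ σ (p, true) = τ (p, true) := by
    intro p
    simpa [dx, dy, tr_zero] using step p 0
  have s1 : ∀ p : ZMod L × ZMod L, σ (p, false) = τ (p, false) →
      σ ((p.1 + 1, p.2), false) = τ ((p.1 + 1, p.2), false) := by
    intro p hp
    rw [step _ 1]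
    simpa [dx, dy, tr] using (s0 p).1 hp
  have s2 : ∀ p : ZMod L × ZMod L, σ (p, false) = τ (p, false) →
      σ ((p.1, p.2 + 1), false) = τ ((p.1, p.2 + 1), false) := by
    intro p hp
    rw [step _ 2]
    simpa [dx, dy, tr] using (s0 p).1 hp
  have hn : ∀ a : ℕ, σ (((a : ZMod L), 0), false) = τ (((a : ZMod L), 0), false) := by
    intro a
    induction a with
    | zero => simpa using h0
    | succ n ih => push_cast; exact s1 _ ih
  have hnn : ∀ a b : ℕ, σ (((a : ZMod L), (b : ZMod L)), false)
      = τ (((a : ZMod L), (b : ZMod L)), false) := by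
    intro a b
    induction b with
    | zero => simpa using hn a
    | succ n ih => push_cast; exact s2 _ ih
  have hf : ∀ p : ZMod L × ZMod L, σ (p, false) = τ (p, false) := by
    rintro ⟨a, b⟩
    have := hnn a.val b.val
    simpa [ZMod.natCast_zmod_val] using this
  funext x
  obtain ⟨p, s⟩ := x
  cases s
  · exact hf p
  · exact (s0 p).1 (hf p)

lemma card_root {L q : ℕ} [NeZero L] (hq : 1 ≤ q) (R : Finset (ZMod L × ZMod L)) :
    (Finset.univ.filter (fun σ : Conf L q => IsRoot σ R)).card ≤ q * (q ^ 98) ^ R.card := by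
  have h1 : (Finset.univ.filter (fun σ : Conf L q => IsRoot σ R)).card ≤
      (Finset.univ : Finset (Fin q × (nearSites R → Fin q))).card := by
    refine Finset.card_le_card_of_injOn (fun σ => (σ ((0, 0), false), fun x => σ x.1))
      (fun _ _ => Finset.mem_coe.mpr (Finset.mem_univ _)) ?_
    intro σ hσ τ hτ h
    simp only [Finset.coe_filter, Finset.mem_univ, true_and, Set.mem_ofPred_eq] at hσ hτ
    simp only [Prod.mk.injEq] at h
    exact agree_all hσ hτ (fun x hx => congrFun h.2 ⟨x, hx⟩) h.1
  refine h1.trans ?_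
  rw [Finset.card_univ, Fintype.card_prod, Fintype.card_fun, Fintype.card_fin,
    Fintype.card_coe, ← pow_mul]
  exact Nat.mul_le_mul_left _ (Nat.pow_le_pow_right hq (card_nearSites R))

lemma Z_le {L q : ℕ} [NeZero L] (hL : 8 ≤ L) (hq : 1 ≤ q) {β : ℝ} (hβ : 0 ≤ β) :
    ∑ σ : Conf L q, Real.exp (-β * (Ham L q σ : ℝ)) ≤
      q * Real.exp ((q : ℝ) ^ 98 * Real.exp (-3 * β) * (L : ℝ) ^ 2) := by
  choose rt hrt1 hrt2 using fun σ : Conf L q => exists_root hL σ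
  set y : ℝ := Real.exp (-3 * β) with hy
  have hy0 : 0 < y := Real.exp_pos _
  have hA : ∀ σ : Conf L q, Real.exp (-β * (Ham L q σ : ℝ)) ≤ y ^ (rt σ).card := by
    intro σ
    rw [hy, ← Real.exp_nat_mul]
    apply Real.exp_le_exp.mpr
    have : (3 : ℝ) * (rt σ).card ≤ Ham L q σ := by exact_mod_cast hrt1 σ
    nlinarith
  calc ∑ σ : Conf L q, Real.exp (-β * (Ham L q σ : ℝ))
      ≤ ∑ σ : Conf L q, y ^ (rt σ).card := Finset.sum_le_sum fun σ _ => hA σ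
    _ = ∑ R : Finset (ZMod L × ZMod L), ∑ σ with rt σ = R, y ^ (rt σ).card :=
        (Finset.sum_fiberwise _ _ _).symm
    _ ≤ ∑ R : Finset (ZMod L × ZMod L), (q : ℝ) * ((q : ℝ) ^ 98 * y) ^ R.card := by
        refine Finset.sum_le_sum fun R _ => ?_
        have h1 : ∑ σ with rt σ = R, y ^ (rt σ).card
            = ((Finset.univ.filter (fun σ : Conf L q => rt σ = R)).card : ℝ) * y ^ R.card := by
          rw [← nsmul_eq_mul]
          apply Finset.sum_eq_card_nsmul
          intro σ hσ
          rw [(Finset.mem_filter.mp hσ).2]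
        have h2 : (Finset.univ.filter (fun σ : Conf L q => rt σ = R)).card
            ≤ q * (q ^ 98) ^ R.card := by
          refine le_trans (Finset.card_le_card ?_) (card_root hq R)
          intro σ hσ
          refine Finset.mem_filter.mpr ⟨Finset.mem_univ _, ?_⟩
          rw [← (Finset.mem_filter.mp hσ).2]
          exact hrt2 σ
        have h3 : ((Finset.univ.filter (fun σ : Conf L q => rt σ = R)).card : ℝ)
            ≤ q * ((q : ℝ) ^ 98) ^ R.card := by exact_mod_cast h2
        rw [h1, mul_pow, ← mul_assoc]
        exact mul_le_mul_of_nonneg_right h3 (by positivity)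
    _ = q * ((q : ℝ) ^ 98 * y + 1) ^ (L ^ 2) := by
        rw [← Finset.mul_sum]
        have := Fintype.sum_pow_mul_eq_add_pow (ZMod L × ZMod L) ((q : ℝ) ^ 98 * y) 1
        simp only [one_pow, mul_one] at this
        rw [this, Fintype.card_prod, ZMod.card, sq]
    _ ≤ q * Real.exp ((q : ℝ) ^ 98 * y * (L : ℝ) ^ 2) := by
        refine mul_le_mul_of_nonneg_left ?_ (by positivity)
        have h1 := Real.add_one_le_exp ((q : ℝ) ^ 98 * y)
        calc ((q : ℝ) ^ 98 * y + 1) ^ (L ^ 2) ≤ Real.exp ((q : ℝ) ^ 98 * y) ^ (L ^ 2) :=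
              pow_le_pow_left₀ (by positivity) h1 _
          _ = _ := by
              rw [← Real.exp_nat_mul]; push_cast; ring_nf

lemma Ham_ground (L q : ℕ) (a : Fin q) : Ham L q (groundConf L q a) = 0 := by
  rw [Ham, Nat.card_eq_zero]
  left
  exact ⟨fun e => e.2.2.2 rfl⟩

lemma gibbs_bounds {L q : ℕ} (hL : 8 ≤ L) (hq : 1 ≤ q) {β : ℝ} (hβ : 1 ≤ β) (M : ℝ) :
    1 - q * Real.exp ((q : ℝ) ^ 98 * Real.exp (-3 * (β - 1)) * (L : ℝ) ^ 2 - M) ≤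
      gibbsP L q β {σ : Conf L q | (Ham L q σ : ℝ) ≤ M} ∧
    gibbsP L q β {σ : Conf L q | (Ham L q σ : ℝ) ≤ M} ≤ 1 := by
  have : NeZero L := ⟨by omega⟩
  set A : Set (Conf L q) := {σ : Conf L q | (Ham L q σ : ℝ) ≤ M} with hA
  set f : Conf L q → ℝ := fun ζ => Real.exp (-β * (Ham L q ζ : ℝ)) with hf
  set Z : ℝ := ∑ σ, f σ with hZ
  have hZ1 : 1 ≤ Z := by
    have h := Finset.single_le_sum (f := f) (fun σ _ => (Real.exp_pos _).le)
      (Finset.mem_univ (groundConf L q ⟨0, hq⟩))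
    have h1 : f (groundConf L q ⟨0, hq⟩) = 1 := by simp [hf, Ham_ground]
    rwa [h1] at h
  have hg : gibbsP L q β A = (∑ σ, A.indicator f σ) / Z := by
    rw [gibbsP, Zfun, tsum_fintype, tsum_fintype]
  have hsplit : ∑ σ, A.indicator f σ + ∑ σ, Aᶜ.indicator f σ = Z := by
    rw [← Finset.sum_add_distrib]
    exact Finset.sum_congr rfl fun σ _ => by
      rw [← Pi.add_apply, Set.indicator_self_add_compl]
  have hnn : 0 ≤ ∑ σ, Aᶜ.indicator f σ :=
    Finset.sum_nonneg fun σ _ => Set.indicator_nonneg (fun _ _ => (Real.exp_pos _).le) _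
  have hub : ∑ σ, Aᶜ.indicator f σ ≤
      q * Real.exp ((q : ℝ) ^ 98 * Real.exp (-3 * (β - 1)) * (L : ℝ) ^ 2 - M) := by
    calc ∑ σ, Aᶜ.indicator f σ
        ≤ ∑ σ : Conf L q, Real.exp (-M) * Real.exp (-(β - 1) * (Ham L q σ : ℝ)) := by
          refine Finset.sum_le_sum fun σ _ => ?_
          by_cases h : σ ∈ A
          · rw [Set.indicator_of_notMem (by simpa using h)]
            positivity
          · rw [Set.indicator_of_mem (by simpa using h), hf, ← Real.exp_add]
            apply Real.exp_le_exp.mpr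
            have : M < (Ham L q σ : ℝ) := by simpa [hA] using h
            linarith
      _ = Real.exp (-M) * ∑ σ : Conf L q, Real.exp (-(β - 1) * (Ham L q σ : ℝ)) := by
          rw [Finset.mul_sum]
      _ ≤ Real.exp (-M) *
          (q * Real.exp ((q : ℝ) ^ 98 * Real.exp (-3 * (β - 1)) * (L : ℝ) ^ 2)) :=
          mul_le_mul_of_nonneg_left (Z_le hL hq (by linarith)) (Real.exp_pos _).le
      _ = _ := by
          rw [sub_eq_add_neg _ M, Real.exp_add]; ring
  have hZ0 : 0 < Z := by linarith
  rw [hg]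
  constructor
  · rw [le_div_iff₀ hZ0]
    have : 0 ≤ q * Real.exp ((q : ℝ) ^ 98 * Real.exp (-3 * (β - 1)) * (L : ℝ) ^ 2 - M) := by
      positivity
    nlinarith
  · rw [div_le_one hZ0]
    linarith

/-- Theorem 3.3(1) (hexagonal lattice): if `e^{β_L} ≪ L^{2/3}`, `α ∈ (0,1)` and
`L^{(2/3)(1-α)} ≪ e^{β_L}`, then for every `c > 0` the Gibbs measure of
`X_{[0, cL^{2α}]}` tends to `1`. -/
theorem gibbs_energy_window_full (q : ℕ) (hq : 2 ≤ q) (β : ℕ → ℝ)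
    (hβ : Filter.Tendsto β Filter.atTop Filter.atTop)
    (hcond : Filter.Tendsto (fun L : ℕ => Real.exp (β L) / (L : ℝ) ^ ((2 : ℝ) / 3))
      Filter.atTop (nhds 0))
    (α : ℝ) (hα0 : 0 < α) (hα1 : α < 1)
    (hcond2 : Filter.Tendsto
      (fun L : ℕ => (L : ℝ) ^ (((2 : ℝ) / 3) * (1 - α)) / Real.exp (β L))
      Filter.atTop (nhds 0)) :
    ∀ c : ℝ, 0 < c →
      Filter.Tendsto (fun L : ℕ => gibbsP L q (β L)
          {σ : Conf L q | (Ham L q σ : ℝ) ≤ c * (L : ℝ) ^ (2 * α)})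
        Filter.atTop (nhds 1) := by
  intro c hc
  set g : ℕ → ℝ := fun L => (L : ℝ) ^ (((2 : ℝ) / 3) * (1 - α)) / Real.exp (β L) with hg
  set K : ℝ := (q : ℝ) ^ 98 * Real.exp 3 with hK
  have hM : Filter.Tendsto (fun L : ℕ => (L : ℝ) ^ (2 * α)) Filter.atTop Filter.atTop :=
    (tendsto_rpow_atTop (by linarith)).comp tendsto_natCast_atTop_atTop
  have hfac : Filter.Tendsto (fun L : ℕ => K * g L ^ 3 - c) Filter.atTop (nhds (-c)) := by
    have := ((hcond2.pow 3).const_mul K).sub_const c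
    simpa using this
  have hexp : Filter.Tendsto (fun L : ℕ => (L : ℝ) ^ (2 * α) * (K * g L ^ 3 - c))
      Filter.atTop Filter.atBot := hM.atTop_mul_neg (by linarith) hfac
  have hlow : Filter.Tendsto
      (fun L : ℕ => 1 - (q : ℝ) * Real.exp ((L : ℝ) ^ (2 * α) * (K * g L ^ 3 - c)))
      Filter.atTop (nhds 1) := by
    have := ((Real.tendsto_exp_atBot.comp hexp).const_mul (q : ℝ)).const_sub 1
    simpa using this
  refine tendsto_of_tendsto_of_tendsto_of_le_of_le' hlow tendsto_const_nhds ?_ ?_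
  · filter_upwards [hβ.eventually_ge_atTop 1, Filter.eventually_ge_atTop 8] with L h1 hL
    have h := (gibbs_bounds (q := q) hL (by omega) h1 (c * (L : ℝ) ^ (2 * α))).1
    refine le_trans (le_of_eq ?_) h
    have hL0 : (0 : ℝ) < L := by exact_mod_cast (by omega : 0 < L)
    have e1 : Real.exp (-3 * (β L - 1)) = Real.exp 3 / Real.exp (β L) ^ 3 := by
      rw [← Real.exp_nat_mul, ← Real.exp_sub]; congr 1; push_cast; ring
    have e2 : (L : ℝ) ^ (2 * α) * ((L : ℝ) ^ (((2 : ℝ) / 3) * (1 - α))) ^ 3 = (L : ℝ) ^ 2 := by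
      rw [← Real.rpow_natCast, ← Real.rpow_mul hL0.le, ← Real.rpow_add hL0,
        ← Real.rpow_natCast]
      congr 1; push_cast; ring
    congr 3
    rw [e1, ← e2, hK, hg]
    simp only [div_pow]
    ring
  · filter_upwards [hβ.eventually_ge_atTop 1, Filter.eventually_ge_atTop 8] with L h1 hL
    exact (gibbs_bounds (q := q) hL (by omega) h1 _).2

end IsingHex
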